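/- Set r = σ2²/σ1², W1 = (X1 − X2)/(1+r), W2 = (r X1 + X2)/(1+r), μ1 = (θ1 − θ2)/(1+r), and for measurable ψ : ℝ^p → ℝ^p let δ_ψ(X) = W2 + ψ(W1). Fix c > 0. Then for either the Kullback–Leibler risk R_KL or the reverse Kullback–Leibler risk R_RKL, the predictive density q_{δ_{ψ_A},c} dominates q_{δ_{ψ_B},c} over {θ : θ1 − θ2 ∈ A} (risk ≤ everywhere with strict inequality somewhere) if and only if ψ_A dominates ψ_B as an estimator of μ1 under squared error loss ‖ψ − μ1‖² for the model W1 ~ N_p(μ1, (σ1²/(1+r)) I_p) with the parametric restriction (1+r)μ1 ∈ A. -/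

import Mathlib

open MeasureTheory Real Set

noncomputable section

abbrev Ep (p : ℕ) := EuclideanSpace ℝ (Fin p)

/-- Density of `N_p(0, v I_p)` evaluated at `u`. -/
def gdens (p : ℕ) (v : ℝ) (u : Ep p) : ℝ :=
  (2 * Real.pi * v) ^ (-(p : ℝ) / 2) * Real.exp (-‖u‖ ^ 2 / (2 * v))

/-- Joint density of `X = (X1, X2)`. -/
def jointDens (p : ℕ) (σ12 σ22 : ℝ) (θ1 θ2 : Ep p) (x : Ep p × Ep p) : ℝ :=
  gdens p σ12 (x.1 - θ1) * gdens p σ22 (x.2 - θ2)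

/-- Kullback–Leibler risk. -/
def klRisk (p : ℕ) (σ12 σ22 σY2 : ℝ) (θ1 θ2 : Ep p)
    (qhat : Ep p × Ep p → Ep p → ℝ) : ℝ :=
  ∫ x : Ep p × Ep p,
    (∫ y : Ep p, gdens p σY2 (y - θ1) *
      Real.log (gdens p σY2 (y - θ1) / qhat x y)) *
    jointDens p σ12 σ22 θ1 θ2 x

/-- Reverse Kullback–Leibler risk. -/
def rklRisk (p : ℕ) (σ12 σ22 σY2 : ℝ) (θ1 θ2 : Ep p)
    (qhat : Ep p × Ep p → Ep p → ℝ) : ℝ :=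
  ∫ x : Ep p × Ep p,
    (∫ y : Ep p, qhat x y * Real.log (qhat x y / gdens p σY2 (y - θ1))) *
    jointDens p σ12 σ22 θ1 θ2 x

/-- The estimator `δ_ψ(X) = W2 + ψ(W1)` with `W1 = (X1 - X2)/(1+r)`,
`W2 = (r X1 + X2)/(1+r)`. -/
def deltaEst (p : ℕ) (r : ℝ) (ψ : Ep p → Ep p) (x : Ep p × Ep p) : Ep p :=
  (1 + r)⁻¹ • (r • x.1 + x.2) + ψ ((1 + r)⁻¹ • (x.1 - x.2))

/-- Squared-error risk of `ψ(W1)` for `W1 ~ N_p(μ1, (σ1²/(1+r)) I_p)`. -/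
def wRisk (p : ℕ) (σ12 : ℝ) (r : ℝ) (ψ : Ep p → Ep p) (μ1 : Ep p) : ℝ :=
  ∫ w : Ep p, ‖ψ w - μ1‖ ^ 2 * gdens p (σ12 / (1 + r)) (w - μ1)

theorem gdens_pos (p : ℕ) {v : ℝ} (hv : 0 < v) (u : Ep p) : 0 < gdens p v u := by
  unfold gdens; positivity

theorem gdens_neg (p : ℕ) (v : ℝ) (u : Ep p) : gdens p v (-u) = gdens p v u := by
  simp [gdens]

theorem continuous_gdens (p : ℕ) (v : ℝ) : Continuous (gdens p v) := by
  unfold gdens; fun_prop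

theorem integrable_exp_neg_mul_sq_norm (p : ℕ) {b : ℝ} (hb : 0 < b) :
    Integrable fun u : Ep p => Real.exp (-b * ‖u‖ ^ 2) := by
  have h := GaussianFourier.integral_rexp_neg_mul_sq_norm (V := Ep p) hb
  refine Integrable.of_integral_ne_zero ?_
  rw [h]
  positivity

theorem integrable_gdens (p : ℕ) {v : ℝ} (hv : 0 < v) : Integrable (gdens p v) := by
  unfold gdens
  refine Integrable.const_mul ?_ _
  refine (integrable_exp_neg_mul_sq_norm p (b := 1 / (2 * v)) (by positivity)).congr ?_
  refine Filter.Eventually.of_forall fun u => ?_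
  simp only
  congr 1
  ring

theorem integral_gdens_pos (p : ℕ) {v : ℝ} (hv : 0 < v) : 0 < ∫ u : Ep p, gdens p v u := by
  have h := integrable_gdens p hv
  rw [integral_pos_iff_support_of_nonneg (fun u => (gdens_pos p hv u).le) h]
  have : Function.support (gdens p v) = univ := by
    ext u; simp [(gdens_pos p hv u).ne']
  rw [this]
  exact isOpen_univ.measure_pos volume univ_nonempty

theorem integrable_sq_norm_mul_gdens (p : ℕ) {v : ℝ} (hv : 0 < v) :
    Integrable fun u : Ep p => ‖u‖ ^ 2 * gdens p v u := by
  have hb := (integrable_exp_neg_mul_sq_norm p (b := 1 / (4 * v)) (by positivity)).const_mul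
    (4 * v * (2 * Real.pi * v) ^ (-(p : ℝ) / 2))
  refine hb.mono' ((continuous_norm.pow 2).mul (continuous_gdens p v)).aestronglyMeasurable ?_
  refine Filter.Eventually.of_forall fun u => ?_
  rw [Real.norm_of_nonneg (mul_nonneg (sq_nonneg _) (gdens_pos p hv u).le)]
  unfold gdens
  set t := ‖u‖ ^ 2 / (4 * v) with ht
  have h1 : ‖u‖ ^ 2 = 4 * v * t := by rw [ht]; field_simp
  have h2 : -‖u‖ ^ 2 / (2 * v) = -t + -t := by rw [ht]; field_simp; ring
  have h3 : -(1 / (4 * v)) * ‖u‖ ^ 2 = -t := by rw [ht]; field_simp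
  rw [h2, h3, h1, Real.exp_add]
  have h4 : t * Real.exp (-t) ≤ 1 := by
    rw [Real.exp_neg, ← div_eq_mul_inv, div_le_one (Real.exp_pos t)]
    linarith [Real.add_one_le_exp t]
  have h5 : 0 ≤ 4 * v * (2 * Real.pi * v) ^ (-(p : ℝ) / 2) * Real.exp (-t) := by positivity
  calc _ = 4 * v * (2 * Real.pi * v) ^ (-(p : ℝ) / 2) * Real.exp (-t) * (t * Real.exp (-t)) := by
        ring
    _ ≤ _ := mul_le_of_le_one_right h5 h4

theorem integrable_sq_norm_add_mul_gdens (p : ℕ) {v : ℝ} (hv : 0 < v) (a : Ep p) :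
    Integrable fun u : Ep p => ‖u + a‖ ^ 2 * gdens p v u := by
  have hb := ((integrable_sq_norm_mul_gdens p hv).const_mul 2).add
    ((integrable_gdens p hv).const_mul (2 * ‖a‖ ^ 2))
  refine hb.mono' (((continuous_id.add continuous_const).norm.pow 2).mul
    (continuous_gdens p v)).aestronglyMeasurable ?_
  refine Filter.Eventually.of_forall fun u => ?_
  have hg := (gdens_pos p hv u).le
  rw [Real.norm_of_nonneg (mul_nonneg (sq_nonneg _) hg)]
  simp only [Pi.add_apply]
  have h := parallelogram_law_with_norm ℝ u a
  have h1 : ‖u + a‖ ^ 2 ≤ 2 * ‖u‖ ^ 2 + 2 * ‖a‖ ^ 2 := by nlinarith [sq_nonneg ‖u - a‖]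
  nlinarith [mul_le_mul_of_nonneg_right h1 hg]

/-- Bias–variance decomposition for the centred Gaussian density. -/
theorem integral_sq_norm_add_mul_gdens (p : ℕ) {v : ℝ} (hv : 0 < v) (a : Ep p) :
    ∫ u : Ep p, ‖u + a‖ ^ 2 * gdens p v u =
      (∫ u : Ep p, ‖u‖ ^ 2 * gdens p v u) + ‖a‖ ^ 2 * ∫ u : Ep p, gdens p v u := by
  have hsymm : ∫ u : Ep p, ‖u + -a‖ ^ 2 * gdens p v u =
      ∫ u : Ep p, ‖u + a‖ ^ 2 * gdens p v u := by
    rw [← integral_neg_eq_self]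
    refine integral_congr_ae (Filter.Eventually.of_forall fun u => ?_)
    simp only
    rw [gdens_neg, ← neg_add, norm_neg]
  have hsum := integral_add (integrable_sq_norm_add_mul_gdens p hv a)
    (integrable_sq_norm_add_mul_gdens p hv (-a))
  have hrhs := integral_add ((integrable_sq_norm_mul_gdens p hv).const_mul 2)
    ((integrable_gdens p hv).const_mul (2 * ‖a‖ ^ 2))
  have heq : ∫ u : Ep p, (‖u + a‖ ^ 2 * gdens p v u + ‖u + -a‖ ^ 2 * gdens p v u) =
      ∫ u : Ep p, (2 * (‖u‖ ^ 2 * gdens p v u) + 2 * ‖a‖ ^ 2 * gdens p v u) := by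
    refine integral_congr_ae (Filter.Eventually.of_forall fun u => ?_)
    have h := parallelogram_law_with_norm ℝ u a
    simp only [← sub_eq_add_neg]
    linear_combination gdens p v u * h
  rw [integral_const_mul, integral_const_mul] at hrhs
  linarith

theorem log_gdens_div_gdens (p : ℕ) {v v' : ℝ} (hv : 0 < v) (hv' : 0 < v') (u w : Ep p) :
    Real.log (gdens p v u / gdens p v' w) =
      Real.log (gdens p v 0 / gdens p v' 0) - ‖u‖ ^ 2 / (2 * v) + ‖w‖ ^ 2 / (2 * v') := by
  rw [Real.log_div (gdens_pos p hv u).ne' (gdens_pos p hv' w).ne',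
    Real.log_div (gdens_pos p hv 0).ne' (gdens_pos p hv' 0).ne']
  have hlog : ∀ {s : ℝ}, 0 < s → ∀ z : Ep p,
      Real.log (gdens p s z) = Real.log (gdens p s 0) - ‖z‖ ^ 2 / (2 * s) := by
    intro s hs z
    have hn : (2 * Real.pi * s) ^ (-(p : ℝ) / 2) ≠ 0 := by positivity
    unfold gdens
    rw [Real.log_mul hn (Real.exp_pos _).ne', Real.log_exp]
    simp
    ring
  rw [hlog hv u, hlog hv' w]
  ring

/-- The Kullback–Leibler divergence between two isotropic Gaussian densities is an affine
function, with positive slope, of the squared distance between their centres. -/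
theorem exists_integral_gdens_mul_log_eq (p : ℕ) {v v' : ℝ} (hv : 0 < v) (hv' : 0 < v') :
    ∃ C k : ℝ, 0 < k ∧ ∀ a b : Ep p,
      ∫ y : Ep p, gdens p v (y - a) * Real.log (gdens p v (y - a) / gdens p v' (y - b)) =
        C + k * ‖a - b‖ ^ 2 := by
  set Z := ∫ u : Ep p, gdens p v u
  set M := ∫ u : Ep p, ‖u‖ ^ 2 * gdens p v u
  set l := Real.log (gdens p v 0 / gdens p v' 0)
  refine ⟨l * Z - 1 / (2 * v) * M + 1 / (2 * v') * M, 1 / (2 * v') * Z,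
    mul_pos (by positivity) (integral_gdens_pos p hv), fun a b => ?_⟩
  have hshift := integral_sub_right_eq_self (μ := (volume : Measure (Ep p)))
    (fun u => gdens p v u * Real.log (gdens p v u / gdens p v' (u + (a - b)))) a
  simp only [sub_add_sub_cancel] at hshift
  rw [hshift]
  have i1 := (integrable_gdens p hv).const_mul l
  have i2 := (integrable_sq_norm_mul_gdens p hv).const_mul (1 / (2 * v))
  have i3 := (integrable_sq_norm_add_mul_gdens p hv (a - b)).const_mul (1 / (2 * v'))
  have hexp : ∫ u : Ep p, gdens p v u * Real.log (gdens p v u / gdens p v' (u + (a - b))) =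
      ∫ u : Ep p, (l * gdens p v u - 1 / (2 * v) * (‖u‖ ^ 2 * gdens p v u)) +
        1 / (2 * v') * (‖u + (a - b)‖ ^ 2 * gdens p v u) := by
    refine integral_congr_ae (Filter.Eventually.of_forall fun u => ?_)
    simp only
    rw [log_gdens_div_gdens p hv hv']
    ring
  have i12 : Integrable fun u : Ep p =>
      l * gdens p v u - 1 / (2 * v) * (‖u‖ ^ 2 * gdens p v u) := i1.sub i2
  rw [hexp, integral_add i12 i3, integral_sub i1 i2, integral_const_mul,
    integral_const_mul, integral_const_mul, integral_sq_norm_add_mul_gdens p hv]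
  ring

/-- The linear change of variables `(X1, X2) ↦ (W1, W2)`. -/
def rotEquiv (p : ℕ) (r : ℝ) (hr : 1 + r ≠ 0) : (Ep p × Ep p) ≃ₗ[ℝ] (Ep p × Ep p) where
  toFun x := ((1 + r)⁻¹ • (x.1 - x.2), (1 + r)⁻¹ • (r • x.1 + x.2))
  map_add' x y := by ext i <;> simp <;> ring
  map_smul' s x := by ext i <;> simp <;> ring
  invFun w := (w.1 + w.2, w.2 - r • w.1)
  left_inv x := by ext i <;> simp <;> field_simp <;> ring
  right_inv w := by ext i <;> simp <;> field_simp <;> ring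

theorem exists_integral_comp_linearEquiv {E : Type*} [NormedAddCommGroup E] [NormedSpace ℝ E]
    [FiniteDimensional ℝ E] [MeasureSpace E] [BorelSpace E]
    [(volume : Measure E).IsAddHaarMeasure] (L : E ≃ₗ[ℝ] E) :
    ∃ κ : ℝ, 0 < κ ∧ ∀ G : E → ℝ, (Integrable (fun x => G (L x)) → Integrable G) ∧
      ∫ x, G (L x) = κ * ∫ w, G w := by
  let e : E ≃ᵐ E := L.toContinuousLinearEquiv.toHomeomorph.toMeasurableEquiv
  have he : ∀ x, e x = L x := fun _ => rfl
  have hH : ((volume : Measure E).map e).IsAddHaarMeasure :=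
    L.toContinuousLinearEquiv.isAddHaarMeasure_map volume
  have hmap := Measure.isAddLeftInvariant_eq_smul ((volume : Measure E).map e) volume
  set κ := Measure.addHaarScalarFactor ((volume : Measure E).map e) volume
  have hκ0 : 0 < κ := Measure.addHaarScalarFactor_pos_of_isAddHaarMeasure _ _
  refine ⟨κ, hκ0, fun G => ⟨fun hG => ?_, ?_⟩⟩
  · have h1 : Integrable G ((volume : Measure E).map e) := (integrable_map_equiv e G).2 hG
    rw [hmap] at h1
    have h2 := h1.smul_measure_nnreal (c := κ⁻¹)
    rwa [smul_smul, inv_mul_cancel₀ hκ0.ne', one_smul] at h2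
  · have h1 := integral_map_equiv (μ := (volume : Measure E)) e G
    rw [hmap, integral_smul_nnreal_measure] at h1
    simp only [he] at h1
    rw [← h1]
    rfl

theorem gdens_add_mul_gdens_sub (p : ℕ) {s r : ℝ} (hs : 0 < s) (hr : 0 < r) :
    ∃ K : ℝ, 0 < K ∧ ∀ a b : Ep p, gdens p s (a + b) * gdens p (r * s) (b - r • a) =
      K * (gdens p (s / (1 + r)) a * gdens p (r * s / (1 + r)) b) := by
  refine ⟨gdens p s 0 * gdens p (r * s) 0 /
    (gdens p (s / (1 + r)) 0 * gdens p (r * s / (1 + r)) 0), ?_, fun a b => ?_⟩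
  · have := gdens_pos p hs 0
    have := gdens_pos p (mul_pos hr hs) 0
    have := gdens_pos p (v := s / (1 + r)) (by positivity) 0
    have := gdens_pos p (v := r * s / (1 + r)) (by positivity) 0
    positivity
  · have hz : ∀ (v : ℝ) (z : Ep p),
        gdens p v z = gdens p v 0 * Real.exp (-‖z‖ ^ 2 / (2 * v)) := by
      intro v z; simp [gdens]
    have h1 := (gdens_pos p (v := s / (1 + r)) (by positivity) 0).ne'
    have h2 := (gdens_pos p (v := r * s / (1 + r)) (by positivity) 0).ne'
    have hexp : Real.exp (-‖a + b‖ ^ 2 / (2 * s)) *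
        Real.exp (-‖b - r • a‖ ^ 2 / (2 * (r * s))) =
        Real.exp (-‖a‖ ^ 2 / (2 * (s / (1 + r)))) *
        Real.exp (-‖b‖ ^ 2 / (2 * (r * s / (1 + r)))) := by
      rw [← Real.exp_add, ← Real.exp_add, norm_add_sq_real, norm_sub_sq_real, norm_smul,
        inner_smul_right, real_inner_comm b a, mul_pow, Real.norm_eq_abs, sq_abs]
      congr 1
      field_simp
      ring
    rw [hz s, hz (r * s), hz (s / (1 + r)) a, hz (r * s / (1 + r)) b]
    rw [mul_mul_mul_comm, mul_mul_mul_comm (gdens p (s / (1 + r)) 0), hexp,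
      ← mul_assoc (_ / _), div_mul_cancel₀ _ (mul_ne_zero h1 h2)]

theorem integrable_jointDens (p : ℕ) {s t : ℝ} (hs : 0 < s) (ht : 0 < t) (θ1 θ2 : Ep p) :
    Integrable (jointDens p s t θ1 θ2) :=
  ((integrable_gdens p hs).comp_sub_right θ1).mul_prod
    ((integrable_gdens p ht).comp_sub_right θ2)

/-- The squared-error risk of `deltaEst` for `θ1` is an increasing affine function of the
squared-error risk of `ψ` for `μ1`. -/
theorem exists_integral_sq_deltaEst_eq (p : ℕ) {s r : ℝ} (hs : 0 < s) (hr : 0 < r)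
    (θ1 θ2 : Ep p) :
    ∃ C k : ℝ, 0 < k ∧ ∀ ψ : Ep p → Ep p,
      Integrable (fun x : Ep p × Ep p =>
        ‖deltaEst p r ψ x - θ1‖ ^ 2 * jointDens p s (r * s) θ1 θ2 x) →
      Integrable (fun w : Ep p => ‖ψ w - (1 + r)⁻¹ • (θ1 - θ2)‖ ^ 2 *
        gdens p (s / (1 + r)) (w - (1 + r)⁻¹ • (θ1 - θ2))) →
      ∫ x : Ep p × Ep p, ‖deltaEst p r ψ x - θ1‖ ^ 2 * jointDens p s (r * s) θ1 θ2 x =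
        C + k * wRisk p s r ψ ((1 + r)⁻¹ • (θ1 - θ2)) := by
  have hr1 : 1 + r ≠ 0 := by positivity
  obtain ⟨K, hK, hfac⟩ := gdens_add_mul_gdens_sub p hs hr
  have : (volume : Measure (Ep p × Ep p)).IsAddHaarMeasure :=
    inferInstanceAs ((volume : Measure (Ep p)).prod volume).IsAddHaarMeasure
  obtain ⟨κ, hκ, hL⟩ := exists_integral_comp_linearEquiv (rotEquiv p r hr1)
  have hv1 : 0 < s / (1 + r) := by positivity
  have hv2 : 0 < r * s / (1 + r) := by positivity
  set v1 := s / (1 + r)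
  set v2 := r * s / (1 + r)
  set μ1 := (1 + r)⁻¹ • (θ1 - θ2) with hμ1
  set μ2 := (1 + r)⁻¹ • (r • θ1 + θ2) with hμ2
  have hsum : μ1 + μ2 = θ1 := by
    rw [hμ1, hμ2]; ext i; simp; field_simp; ring
  have hdiff : μ2 - r • μ1 = θ2 := by
    rw [hμ1, hμ2]; ext i; simp; field_simp; ring
  set Z := ∫ u : Ep p, gdens p v2 u
  set M := ∫ u : Ep p, ‖u‖ ^ 2 * gdens p v2 u
  refine ⟨κ * (K * (M * ∫ w : Ep p, gdens p v1 (w - μ1))), κ * (K * Z),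
    mul_pos hκ (mul_pos hK (integral_gdens_pos p hv2)), fun ψ hψ hψW => ?_⟩
  let G : Ep p × Ep p → ℝ := fun w =>
    K * (gdens p v1 (w.1 - μ1) * (‖(w.2 - μ2) + (ψ w.1 - μ1)‖ ^ 2 * gdens p v2 (w.2 - μ2)))
  have hFG : (fun x : Ep p × Ep p =>
      ‖deltaEst p r ψ x - θ1‖ ^ 2 * jointDens p s (r * s) θ1 θ2 x) =
      fun x => G (rotEquiv p r hr1 x) := by
    funext x
    obtain ⟨w, rfl⟩ := (rotEquiv p r hr1).symm.surjective x
    rw [LinearEquiv.apply_symm_apply]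
    have hw := (rotEquiv p r hr1).apply_symm_apply w
    have hx1 : ((rotEquiv p r hr1).symm w).1 - θ1 = (w.1 - μ1) + (w.2 - μ2) := by
      rw [← hsum]; change w.1 + w.2 - _ = _; abel
    have hx2 : ((rotEquiv p r hr1).symm w).2 - θ2 = (w.2 - μ2) - r • (w.1 - μ1) := by
      rw [← hdiff, smul_sub]; change w.2 - r • w.1 - _ = _; abel
    have hδ : deltaEst p r ψ ((rotEquiv p r hr1).symm w) - θ1 =
        (w.2 - μ2) + (ψ w.1 - μ1) := by
      have h : deltaEst p r ψ ((rotEquiv p r hr1).symm w) = w.2 + ψ w.1 :=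
        congrArg (fun z : Ep p × Ep p => z.2 + ψ z.1) hw
      rw [h, ← hsum]; abel
    simp only [jointDens, G]
    rw [hδ, hx1, hx2, hfac]
    ring
  rw [hFG] at hψ ⊢
  obtain ⟨hGi, hGe⟩ := hL G
  have hinner : ∀ w1 : Ep p, ∫ w2 : Ep p, G (w1, w2) =
      K * (M * gdens p v1 (w1 - μ1)) + K * (Z * (‖ψ w1 - μ1‖ ^ 2 * gdens p v1 (w1 - μ1))) := by
    intro w1
    simp only [G]
    rw [integral_const_mul, integral_const_mul,
      integral_sub_right_eq_self (fun u => ‖u + (ψ w1 - μ1)‖ ^ 2 * gdens p v2 u) μ2,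
      integral_sq_norm_add_mul_gdens p hv2]
    ring
  rw [hGe, Measure.volume_eq_prod, integral_prod G (hGi hψ)]
  simp only [hinner]
  rw [integral_add ((((integrable_gdens p hv1).comp_sub_right μ1).const_mul M).const_mul K)
    ((hψW.const_mul Z).const_mul K)]
  simp only [integral_const_mul]
  unfold wRisk
  ring

/-- A risk whose pointwise loss is affine in the squared error of `deltaEst`, with positive
slope, orders two estimators as their squared-error risks for `μ1` do. -/
theorem exists_integral_affine_sq_deltaEst_eq (p : ℕ) {s r : ℝ} (hs : 0 < s) (hr : 0 < r)
    (C k : ℝ) (hk : 0 < k) (θ1 θ2 : Ep p) :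
    ∃ C' k' : ℝ, 0 < k' ∧ ∀ ψ : Ep p → Ep p,
      Integrable (fun x : Ep p × Ep p =>
        ‖deltaEst p r ψ x - θ1‖ ^ 2 * jointDens p s (r * s) θ1 θ2 x) →
      Integrable (fun w : Ep p => ‖ψ w - (1 + r)⁻¹ • (θ1 - θ2)‖ ^ 2 *
        gdens p (s / (1 + r)) (w - (1 + r)⁻¹ • (θ1 - θ2))) →
      ∫ x : Ep p × Ep p, (C + k * ‖deltaEst p r ψ x - θ1‖ ^ 2) *
          jointDens p s (r * s) θ1 θ2 x =
        C' + k' * wRisk p s r ψ ((1 + r)⁻¹ • (θ1 - θ2)) := by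
  obtain ⟨D, l, hl, h⟩ := exists_integral_sq_deltaEst_eq p hs hr θ1 θ2
  refine ⟨C * (∫ x, jointDens p s (r * s) θ1 θ2 x) + k * D, k * l, mul_pos hk hl,
    fun ψ hψ hψW => ?_⟩
  simp only [add_mul, mul_assoc]
  rw [integral_add ((integrable_jointDens p hs (mul_pos hr hs) θ1 θ2).const_mul C)
    (hψ.const_mul k), integral_const_mul, integral_const_mul, h ψ hψ hψW]
  ring

/-- Domination over `{θ | θ1 - θ2 ∈ A}` transfers along a parametrisation by
`μ1 = (θ1 - θ2) / (1 + r)` under which the two risks are ordered alike. -/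
theorem dominates_iff_of_affine {p : ℕ} {A : Set (Ep p)} {r : ℝ} (hr : 1 + r ≠ 0)
    {RA RB : Ep p → Ep p → ℝ} {SA SB : Ep p → ℝ}
    (h : ∀ θ1 θ2, θ1 - θ2 ∈ A → ∃ C k : ℝ, 0 < k ∧
      RA θ1 θ2 = C + k * SA ((1 + r)⁻¹ • (θ1 - θ2)) ∧
      RB θ1 θ2 = C + k * SB ((1 + r)⁻¹ • (θ1 - θ2))) :
    ((∀ θ1 θ2, θ1 - θ2 ∈ A → RA θ1 θ2 ≤ RB θ1 θ2) ∧
      ∃ θ1 θ2, θ1 - θ2 ∈ A ∧ RA θ1 θ2 < RB θ1 θ2) ↔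
    ((∀ μ, (1 + r) • μ ∈ A → SA μ ≤ SB μ) ∧ ∃ μ, (1 + r) • μ ∈ A ∧ SA μ < SB μ) := by
  have hle : ∀ θ1 θ2, θ1 - θ2 ∈ A → (RA θ1 θ2 ≤ RB θ1 θ2 ↔
      SA ((1 + r)⁻¹ • (θ1 - θ2)) ≤ SB ((1 + r)⁻¹ • (θ1 - θ2))) := by
    intro θ1 θ2 hθ
    obtain ⟨C, k, hk, h1, h2⟩ := h θ1 θ2 hθ
    rw [h1, h2, add_le_add_iff_left, mul_le_mul_iff_right₀ hk]
  have hlt : ∀ θ1 θ2, θ1 - θ2 ∈ A → (RA θ1 θ2 < RB θ1 θ2 ↔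
      SA ((1 + r)⁻¹ • (θ1 - θ2)) < SB ((1 + r)⁻¹ • (θ1 - θ2))) := by
    intro θ1 θ2 hθ
    obtain ⟨C, k, hk, h1, h2⟩ := h θ1 θ2 hθ
    rw [h1, h2, add_lt_add_iff_left, mul_lt_mul_iff_right₀ hk]
  have hback : ∀ μ : Ep p, (1 + r)⁻¹ • ((1 + r) • μ - 0) = μ := fun μ => by
    rw [sub_zero, inv_smul_smul₀ hr]
  have hfwd : ∀ θ1 θ2 : Ep p, θ1 - θ2 ∈ A → (1 + r) • (1 + r)⁻¹ • (θ1 - θ2) ∈ A :=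
    fun θ1 θ2 hθ => by rwa [smul_inv_smul₀ hr]
  constructor
  · rintro ⟨hall, θ1, θ2, hθ, hs⟩
    refine ⟨fun μ hμ => ?_, _, hfwd θ1 θ2 hθ, (hlt θ1 θ2 hθ).1 hs⟩
    have hμ' : (1 + r) • μ - 0 ∈ A := by rwa [sub_zero]
    simpa only [hback] using (hle _ _ hμ').1 (hall _ _ hμ')
  · rintro ⟨hall, μ, hμ, hs⟩
    have hμ' : (1 + r) • μ - 0 ∈ A := by rwa [sub_zero]
    exact ⟨fun θ1 θ2 hθ => (hle θ1 θ2 hθ).2 (hall _ (hfwd θ1 θ2 hθ)),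
      _, 0, hμ', (hlt _ _ hμ').2 (by rwa [hback])⟩

/-- For fixed `c > 0` and for either Kullback–Leibler or reverse Kullback–Leibler risk,
`q_{δ_{ψA},c}` dominates `q_{δ_{ψB},c}` over `{θ : θ1 - θ2 ∈ A}` if and only if `ψA`
dominates `ψB` as an estimator of `μ1` under squared error loss for
`W1 ~ N_p(μ1, (σ1²/(1+r)) I_p)` with the restriction `(1+r) μ1 ∈ A`. -/
theorem stmt4 (p : ℕ) (σ12 σ22 σY2 : ℝ)
    (hσ1 : 0 < σ12) (hσ2 : 0 < σ22) (hσY : 0 < σY2)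
    (A : Set (Ep p)) (hA : MeasurableSet A)
    (r : ℝ) (hr : r = σ22 / σ12) (c : ℝ) (hc : 0 < c)
    (ψA ψB : Ep p → Ep p) (hψA : Measurable ψA) (hψB : Measurable ψB)
    (hintXA : ∀ θ1 θ2 : Ep p, θ1 - θ2 ∈ A →
      Integrable (fun x : Ep p × Ep p =>
        ‖deltaEst p r ψA x - θ1‖ ^ 2 * jointDens p σ12 σ22 θ1 θ2 x))
    (hintXB : ∀ θ1 θ2 : Ep p, θ1 - θ2 ∈ A →
      Integrable (fun x : Ep p × Ep p =>
        ‖deltaEst p r ψB x - θ1‖ ^ 2 * jointDens p σ12 σ22 θ1 θ2 x))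
    (hintWA : ∀ μ1 : Ep p, (1 + r) • μ1 ∈ A →
      Integrable (fun w : Ep p => ‖ψA w - μ1‖ ^ 2 * gdens p (σ12 / (1 + r)) (w - μ1)))
    (hintWB : ∀ μ1 : Ep p, (1 + r) • μ1 ∈ A →
      Integrable (fun w : Ep p => ‖ψB w - μ1‖ ^ 2 * gdens p (σ12 / (1 + r)) (w - μ1))) :
    (((∀ θ1 θ2 : Ep p, θ1 - θ2 ∈ A →
        klRisk p σ12 σ22 σY2 θ1 θ2 (fun x y => gdens p (c * σY2) (y - deltaEst p r ψA x)) ≤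
        klRisk p σ12 σ22 σY2 θ1 θ2 (fun x y => gdens p (c * σY2) (y - deltaEst p r ψB x))) ∧
      (∃ θ1 θ2 : Ep p, θ1 - θ2 ∈ A ∧
        klRisk p σ12 σ22 σY2 θ1 θ2 (fun x y => gdens p (c * σY2) (y - deltaEst p r ψA x)) <
        klRisk p σ12 σ22 σY2 θ1 θ2 (fun x y => gdens p (c * σY2) (y - deltaEst p r ψB x)))) ↔
      ((∀ μ1 : Ep p, (1 + r) • μ1 ∈ A → wRisk p σ12 r ψA μ1 ≤ wRisk p σ12 r ψB μ1) ∧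
       (∃ μ1 : Ep p, (1 + r) • μ1 ∈ A ∧ wRisk p σ12 r ψA μ1 < wRisk p σ12 r ψB μ1))) ∧
    (((∀ θ1 θ2 : Ep p, θ1 - θ2 ∈ A →
        rklRisk p σ12 σ22 σY2 θ1 θ2 (fun x y => gdens p (c * σY2) (y - deltaEst p r ψA x)) ≤
        rklRisk p σ12 σ22 σY2 θ1 θ2 (fun x y => gdens p (c * σY2) (y - deltaEst p r ψB x))) ∧
      (∃ θ1 θ2 : Ep p, θ1 - θ2 ∈ A ∧
        rklRisk p σ12 σ22 σY2 θ1 θ2 (fun x y => gdens p (c * σY2) (y - deltaEst p r ψA x)) <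
        rklRisk p σ12 σ22 σY2 θ1 θ2 (fun x y => gdens p (c * σY2) (y - deltaEst p r ψB x)))) ↔
      ((∀ μ1 : Ep p, (1 + r) • μ1 ∈ A → wRisk p σ12 r ψA μ1 ≤ wRisk p σ12 r ψB μ1) ∧
       (∃ μ1 : Ep p, (1 + r) • μ1 ∈ A ∧ wRisk p σ12 r ψA μ1 < wRisk p σ12 r ψB μ1))) := by
  have hr0 : 0 < r := by rw [hr]; positivity
  have hr1 : 1 + r ≠ 0 := by positivity
  have h22 : σ22 = r * σ12 := by rw [hr]; field_simp
  clear hr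
  subst h22
  have hcY : 0 < c * σY2 := mul_pos hc hσY
  have hmem : ∀ θ1 θ2 : Ep p, θ1 - θ2 ∈ A → (1 + r) • (1 + r)⁻¹ • (θ1 - θ2) ∈ A :=
    fun θ1 θ2 hθ => by rwa [smul_inv_smul₀ hr1]
  constructor
  · obtain ⟨C, k, hk, hC⟩ := exists_integral_gdens_mul_log_eq p hσY hcY
    refine dominates_iff_of_affine hr1 fun θ1 θ2 hθ => ?_
    obtain ⟨C', k', hk', h⟩ :=
      exists_integral_affine_sq_deltaEst_eq p hσ1 hr0 C k hk θ1 θ2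
    refine ⟨C', k', hk', ?_, ?_⟩
    · rw [← h ψA (hintXA θ1 θ2 hθ) (hintWA _ (hmem θ1 θ2 hθ))]
      simp only [klRisk, hC, norm_sub_rev θ1]
    · rw [← h ψB (hintXB θ1 θ2 hθ) (hintWB _ (hmem θ1 θ2 hθ))]
      simp only [klRisk, hC, norm_sub_rev θ1]
  · obtain ⟨C, k, hk, hC⟩ := exists_integral_gdens_mul_log_eq p hcY hσY
    refine dominates_iff_of_affine hr1 fun θ1 θ2 hθ => ?_
    obtain ⟨C', k', hk', h⟩ :=
      exists_integral_affine_sq_deltaEst_eq p hσ1 hr0 C k hk θ1 θ2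
    refine ⟨C', k', hk', ?_, ?_⟩
    · rw [← h ψA (hintXA θ1 θ2 hθ) (hintWA _ (hmem θ1 θ2 hθ))]
      simp only [rklRisk, hC]
    · rw [← h ψB (hintXB θ1 θ2 hθ) (hintWB _ (hmem θ1 θ2 hθ))]
      simp only [rklRisk, hC]

end
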